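/- (Characterization of the kernel of the generator.) Assume V ∈ C^∞(𝕋^d). If h ∈ C^∞(X) satisfies 𝓛 h = 0 pointwise on X and h together with all its partial derivatives belongs to L²(μ_β), then h is constant. -/

import Mathlib

open MeasureTheory Real Filter

noncomputable section

/-- The state space `X = 𝕋^d × ℝ^d × ℝ^{dm}`, realised as
`ℝ^d × ℝ^d × (ℝ^d)^m` with functions that are `ℤ^d`-periodic in the first variable. -/
abbrev Xsp (d m : ℕ) := (Fin d → ℝ) × (Fin d → ℝ) × (Fin m → Fin d → ℝ)

/-- The direction in the `z_j`-block given by the vector `v`. -/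
def zdir (d m : ℕ) (j : Fin m) (v : Fin d → ℝ) : Xsp d m :=
  (0, 0, Function.update 0 j v)

/-- The partial derivative `∂_{z_{j,k}} φ`. -/
def pZ (d m : ℕ) (j : Fin m) (k : Fin d) (φ : Xsp d m → ℝ) (x : Xsp d m) : ℝ :=
  fderiv ℝ φ x (zdir d m j (Pi.single k 1))

/-- The partial derivative `∂_{p_k} φ`. -/
def pP (d m : ℕ) (k : Fin d) (φ : Xsp d m → ℝ) (x : Xsp d m) : ℝ :=
  fderiv ℝ φ x (0, Pi.single k 1, 0)

/-- The partial derivative `∂_{q_k} φ`. -/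
def pQ (d m : ℕ) (k : Fin d) (φ : Xsp d m → ℝ) (x : Xsp d m) : ℝ :=
  fderiv ℝ φ x (Pi.single k 1, 0, 0)

/-- The operator `𝓛` (negative of the generator of the Markovian GLE dynamics):
`𝓛φ = −p·∇_qφ + ∇V·∇_pφ − Σ_j λ_j z_j·∇_pφ + Σ_j λ_j p·∇_{z_j}φ
      + Σ_j α_j z_j·∇_{z_j}φ − β⁻¹ Σ_j α_j Δ_{z_j}φ`. -/
def gen (d m : ℕ) (β : ℝ) (α lam : Fin m → ℝ) (V : (Fin d → ℝ) → ℝ)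
    (φ : Xsp d m → ℝ) (x : Xsp d m) : ℝ :=
  - fderiv ℝ φ x (x.2.1, 0, 0)
  + fderiv ℝ φ x (0, (fun i => fderiv ℝ V x.1 (Pi.single i 1)), 0)
  - fderiv ℝ φ x (0, ∑ j, lam j • x.2.2 j, 0)
  + ∑ j, lam j * fderiv ℝ φ x (zdir d m j x.2.1)
  + ∑ j, α j * fderiv ℝ φ x (zdir d m j (x.2.2 j))
  - β⁻¹ * ∑ j, α j * ∑ k, fderiv ℝ (pZ d m j k φ) x (zdir d m j (Pi.single k 1))

/-- The (unnormalised) Gibbs density `exp(−β(V(q) + |p|²/2 + |z|²/2))`. -/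
def gdens (d m : ℕ) (β : ℝ) (V : (Fin d → ℝ) → ℝ) (x : Xsp d m) : ℝ :=
  Real.exp (-β * (V x.1 + (∑ i, (x.2.1 i) ^ 2) / 2 + (∑ j, ∑ i, (x.2.2 j i) ^ 2) / 2))

/-- The fundamental domain `[0,1)^d` for the torus in the `q`-variable. -/
def cube (d : ℕ) : Set (Fin d → ℝ) := {q | ∀ i, q i ∈ Set.Ico (0 : ℝ) 1}

/-- Lebesgue measure on `X = 𝕋^d × ℝ^d × ℝ^{dm}` (the `q`-variable being
restricted to a fundamental domain of the torus). -/
def volX (d m : ℕ) : Measure (Xsp d m) :=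
  (volume : Measure (Xsp d m)).restrict {x | x.1 ∈ cube d}

/-- The Gibbs measure `μ_β`, with density `Z⁻¹ exp(−β(V(q)+|p|²/2+|z|²/2))`. -/
def gibbs (d m : ℕ) (β Z : ℝ) (V : (Fin d → ℝ) → ℝ) : Measure (Xsp d m) :=
  (volX d m).withDensity fun x => ENNReal.ofReal (Z⁻¹ * gdens d m β V x)

/-- `ℤ^d`-periodicity in the `q`-variable. -/
def PerQ (d m : ℕ) (φ : Xsp d m → ℝ) : Prop :=
  ∀ (k : Fin d → ℤ) (x : Xsp d m), φ (x.1 + (fun i => (k i : ℝ)), x.2) = φ x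

/-- `ℤ^d`-periodicity of the potential. -/
def PerV (d : ℕ) (V : (Fin d → ℝ) → ℝ) : Prop :=
  ∀ (k : Fin d → ℤ) (q : Fin d → ℝ), V (q + fun i => (k i : ℝ)) = V q

/-- A test function: smooth, periodic in `q`, compactly supported in `(p,z)`. -/
def IsTest (d m : ℕ) (φ : Xsp d m → ℝ) : Prop :=
  ContDiff ℝ (⊤ : ℕ∞) φ ∧ PerQ d m φ ∧
    ∃ K : Set ((Fin d → ℝ) × (Fin m → Fin d → ℝ)),
      IsCompact K ∧ ∀ x : Xsp d m, x.2 ∉ K → φ x = 0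

instance (d m : ℕ) :
    (volume : Measure ((Fin d → ℝ) × (Fin m → Fin d → ℝ))).IsAddHaarMeasure := by
  have : (volume : Measure (Fin m → Fin d → ℝ)).IsAddHaarMeasure :=
    Measure.pi.isAddHaarMeasure (α := fun _ => Fin d → ℝ) fun _ => volume
  rw [Measure.volume_eq_prod]; infer_instance

instance (d m : ℕ) : (volume : Measure (Xsp d m)).IsAddHaarMeasure :=
  Measure.prod.instIsAddHaarMeasure volume volume

/-- A function vanishing off `{x | x.2 ∈ K}`, `K` closed, has its derivative vanishing there too. -/
lemma fderiv_eq_zero_of_snd_notMem {d m : ℕ} {F : Xsp d m → ℝ}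
    {K : Set ((Fin d → ℝ) × (Fin m → Fin d → ℝ))} (hK : IsCompact K)
    (h0 : ∀ x : Xsp d m, x.2 ∉ K → F x = 0) {x : Xsp d m} (hx : x.2 ∉ K) :
    fderiv ℝ F x = 0 := by
  have : F =ᶠ[nhds x] fun _ => 0 := by
    have hopen : IsOpen {y : Xsp d m | y.2 ∉ K} :=
      hK.isClosed.isOpen_compl.preimage continuous_snd
    filter_upwards [hopen.mem_nhds hx] with y hy using h0 y hy
  rw [this.fderiv_eq]; simp

lemma cube_eq_pi (d : ℕ) : cube d = Set.univ.pi fun _ => Set.Ico (0 : ℝ) 1 := by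
  ext; simp [cube, Set.mem_pi]

lemma volX_eq_prod (d m : ℕ) :
    volX d m = ((volume : Measure (Fin d → ℝ)).restrict (cube d)).prod volume := by
  have h : {x : Xsp d m | x.1 ∈ cube d} = cube d ×ˢ Set.univ := by ext; simp
  rw [volX, h, Measure.volume_eq_prod, ← Measure.prod_restrict, Measure.restrict_univ]

lemma integrable_volX_of_snd_compact {d m : ℕ} {G : Xsp d m → ℝ} (hG : Continuous G)
    {K : Set ((Fin d → ℝ) × (Fin m → Fin d → ℝ))} (hK : IsCompact K)
    (h0 : ∀ x : Xsp d m, x.2 ∉ K → G x = 0) : Integrable G (volX d m) := by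
  have hc : IsCompact ((Set.Icc (0 : Fin d → ℝ) 1) ×ˢ K) := isCompact_Icc.prod hK
  have h1 : IntegrableOn G ((Set.Icc (0 : Fin d → ℝ) 1) ×ˢ K) volume :=
    hG.continuousOn.integrableOn_compact hc
  have h2 : IntegrableOn G ((Set.Icc (0 : Fin d → ℝ) 1) ×ˢ Set.univ) volume :=
    h1.of_forall_sdiff_eq_zero (isClosed_Icc.measurableSet.prod MeasurableSet.univ) (by
      rintro ⟨q, y⟩ ⟨⟨hq, _⟩, hx⟩
      exact h0 _ fun hy => hx ⟨hq, hy⟩)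
  refine h2.mono_set ?_
  rintro ⟨q, y⟩ hq
  exact ⟨⟨fun i => (hq i).1, fun i => (hq i).2.le⟩, trivial⟩

/-- Integration along the momentum and auxiliary variables: a vector field that is constant along
its own direction is divergence free. -/
lemma integral_mul_fderiv_snd_eq_zero {d m : ℕ} {F c : Xsp d m → ℝ} (hF : ContDiff ℝ 1 F)
    (hc : Continuous c) {K : Set ((Fin d → ℝ) × (Fin m → Fin d → ℝ))} (hK : IsCompact K)
    (h0 : ∀ x : Xsp d m, x.2 ∉ K → F x = 0) (v : (Fin d → ℝ) × (Fin m → Fin d → ℝ))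
    (hcv : ∀ (x : Xsp d m) (t : ℝ), c (x + t • ((0, v) : Xsp d m)) = c x) :
    Integrable (fun x => c x * fderiv ℝ F x (0, v)) (volX d m) ∧
      ∫ x, c x * fderiv ℝ F x (0, v) ∂(volX d m) = 0 := by
  have hcont : Continuous fun x => c x * fderiv ℝ F x ((0, v) : Xsp d m) :=
    hc.mul ((hF.continuous_fderiv one_ne_zero).clm_apply continuous_const)
  have hint : Integrable (fun x => c x * fderiv ℝ F x (0, v)) (volX d m) :=
    integrable_volX_of_snd_compact hcont hK fun x hx => by
      simp [fderiv_eq_zero_of_snd_notMem hK h0 hx]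
  refine ⟨hint, ?_⟩
  rw [volX_eq_prod] at hint ⊢
  rw [integral_prod _ hint]
  refine integral_eq_zero_of_ae (Eventually.of_forall fun q => ?_)
  have hcs (G : Xsp d m → ℝ) (hG : Continuous G) (hG0 : ∀ x : Xsp d m, x.2 ∉ K → G x = 0) :
      Integrable (fun y => G (q, y)) volume := by
    refine Continuous.integrable_of_hasCompactSupport (by fun_prop) ?_
    exact HasCompactSupport.intro hK fun y hy => hG0 (q, y) hy
  have key := integral_bilinear_hasLineDerivAt_right_eq_neg_left_of_integrable
    (μ := (volume : Measure ((Fin d → ℝ) × (Fin m → Fin d → ℝ))))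
    (f := fun y => c (q, y)) (f' := fun _ => 0) (g := fun y => F (q, y))
    (g' := fun y => fderiv ℝ F (q, y) (0, v)) (v := v) (B := ContinuousLinearMap.mul ℝ ℝ)
    (by simp) (hcs _ hcont fun x hx => by simp [fderiv_eq_zero_of_snd_notMem hK h0 hx])
    (hcs (fun x => c x * F x) (hc.mul hF.continuous) fun x hx => by simp [h0 x hx])
    (fun y _ => by
      have : (fun t : ℝ => c (q, y + t • v)) = fun _ => c (q, y) := by
        ext t
        simpa using hcv (q, y) t
      simp only [HasLineDerivAt, this]
      exact hasDerivAt_const _ _)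
    (fun y _ => by
      have h1 : HasFDerivAt (fun y => F (q, y)) _ y :=
        ((hF.differentiable one_ne_zero (q, y)).hasFDerivAt).comp y (hasFDerivAt_prodMk_right q y)
      simpa using h1.hasLineDerivAt v)
  simpa using key

lemma integral_fderiv_snd_linear_eq_zero {d m : ℕ} {F : Xsp d m → ℝ} (hF : ContDiff ℝ 1 F)
    {K : Set ((Fin d → ℝ) × (Fin m → Fin d → ℝ))} (hK : IsCompact K)
    (h0 : ∀ x : Xsp d m, x.2 ∉ K → F x = 0)
    (ι : (Fin d → ℝ) →ₗ[ℝ] (Fin d → ℝ) × (Fin m → Fin d → ℝ))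
    {b : Xsp d m → Fin d → ℝ} (hb : Continuous b)
    (hbv : ∀ (x : Xsp d m) (u : Fin d → ℝ), b (x + ((0, ι u) : Xsp d m)) = b x) :
    Integrable (fun x => fderiv ℝ F x (0, ι (b x))) (volX d m) ∧
      ∫ x, fderiv ℝ F x (0, ι (b x)) ∂(volX d m) = 0 := by
  have hsum : (fun x => fderiv ℝ F x (0, ι (b x))) =
      fun x => ∑ i, b x i * fderiv ℝ F x (0, ι (Pi.single i 1)) := by
    ext x
    let L : (Fin d → ℝ) →ₗ[ℝ] ℝ :=
      (fderiv ℝ F x).toLinearMap ∘ₗ (LinearMap.inr ℝ (Fin d → ℝ) _) ∘ₗ ι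
    change L (b x) = ∑ i, b x i * L (Pi.single i 1)
    rw [L.pi_apply_eq_sum_univ]
    refine Finset.sum_congr rfl fun i _ => ?_
    rw [smul_eq_mul]
    congr 3
    ext j
    simp [Pi.single_apply, eq_comm]
  have hi (i : Fin d) := integral_mul_fderiv_snd_eq_zero hF (c := fun x => b x i) (by fun_prop) hK h0
    (ι (Pi.single i 1)) (fun x t => by
      have := hbv x (t • Pi.single i 1)
      simp only [map_smul] at this
      simp [this])
  rw [hsum]
  refine ⟨integrable_finsetSum _ fun i _ => (hi i).1, ?_⟩
  rw [integral_finsetSum _ fun i _ => (hi i).1]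
  exact Finset.sum_eq_zero fun i _ => (hi i).2

/-- The divergence theorem on the torus for a constant vector field. -/
lemma integral_cube_fderiv_eq_zero {d : ℕ} {F : (Fin d → ℝ) → ℝ} (hF : ContDiff ℝ 1 F)
    (hper : ∀ (k : Fin d → ℤ) q, F (q + fun i => (k i : ℝ)) = F q) (v : Fin d → ℝ) :
    ∫ q in cube d, fderiv ℝ F q v = 0 := by
  obtain _ | n := d
  · rw [Subsingleton.elim v 0]
    simp only [map_zero, integral_zero]
  have hset : cube (n + 1) =ᵐ[volume] Set.Icc (0 : Fin (n + 1) → ℝ) 1 := by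
    rw [cube_eq_pi]; exact Measure.univ_pi_Ico_ae_eq_Icc
  rw [setIntegral_congr_set hset]
  have hsum (x) : fderiv ℝ F x v = ∑ i, (v i • fderiv ℝ F x) (Pi.single i 1) := by
    conv_lhs => rw [← Finset.univ_sum_single v, map_sum]
    refine Finset.sum_congr rfl fun i _ => ?_
    rw [_root_.smul_apply, ← map_smul, ← Pi.single_smul]
    simp
  have hcont : Continuous fun q => fderiv ℝ F q v :=
    (hF.continuous_fderiv one_ne_zero).clm_apply continuous_const
  have key := integral_divergence_of_hasFDerivAt_off_countable' (0 : Fin (n + 1) → ℝ) 1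
    zero_le_one (fun i q => v i • F q) (fun i q => v i • fderiv ℝ F q) ∅ Set.countable_empty
    (fun i => (hF.continuous.const_smul (v i)).continuousOn)
    (fun x _ i => ((hF.differentiable one_ne_zero x).hasFDerivAt).const_smul (v i))
    (by
      simp only [← hsum]
      exact hcont.continuousOn.integrableOn_compact isCompact_Icc)
  simp only [← hsum] at key
  rw [key]
  refine Finset.sum_eq_zero fun i _ => ?_
  rw [sub_eq_zero]
  congr 1
  ext x
  rw [← hper (Pi.single i 1) (i.insertNth ((0 : Fin (n + 1) → ℝ) i) x)]
  congr 2
  ext j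
  refine Fin.succAboveCases i ?_ (fun j => ?_) j <;> simp

lemma integral_fderiv_fst_eq_zero {d m : ℕ} {F : Xsp d m → ℝ} (hF : ContDiff ℝ 1 F)
    (hper : PerQ d m F) {K : Set ((Fin d → ℝ) × (Fin m → Fin d → ℝ))} (hK : IsCompact K)
    (h0 : ∀ x : Xsp d m, x.2 ∉ K → F x = 0) :
    Integrable (fun x => fderiv ℝ F x (x.2.1, 0, 0)) (volX d m) ∧
      ∫ x, fderiv ℝ F x (x.2.1, 0, 0) ∂(volX d m) = 0 := by
  have hcont : Continuous fun x : Xsp d m => fderiv ℝ F x (x.2.1, 0, 0) :=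
    (hF.continuous_fderiv one_ne_zero).clm_apply (by fun_prop)
  have hint : Integrable (fun x => fderiv ℝ F x (x.2.1, 0, 0)) (volX d m) :=
    integrable_volX_of_snd_compact hcont hK fun x hx => by
      simp [fderiv_eq_zero_of_snd_notMem hK h0 hx]
  refine ⟨hint, ?_⟩
  rw [volX_eq_prod] at hint ⊢
  rw [integral_prod_symm _ hint]
  refine integral_eq_zero_of_ae (Eventually.of_forall fun y => ?_)
  have h1 (q) : fderiv ℝ (fun q => F (q, y)) q y.1 = fderiv ℝ F (q, y) (y.1, 0, 0) := by
    have : HasFDerivAt (fun q => F (q, y)) _ q :=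
      ((hF.differentiable one_ne_zero (q, y)).hasFDerivAt).comp q (hasFDerivAt_prodMk_left q y)
    rw [this.fderiv]; rfl
  have := integral_cube_fderiv_eq_zero (F := fun q => F (q, y)) (by fun_prop)
    (fun k q => hper k (q, y)) y.1
  simpa [h1] using this

/-- The Hamiltonian `V(q) + |p|²/2 + |z|²/2` of the extended system. -/
def energy (d m : ℕ) (V : (Fin d → ℝ) → ℝ) (x : Xsp d m) : ℝ :=
  V x.1 + (∑ i, (x.2.1 i) ^ 2) / 2 + (∑ j, ∑ i, (x.2.2 j i) ^ 2) / 2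

/-- The Hamiltonian part of `gen`. -/
def hamiltonianPart (d m : ℕ) (lam : Fin m → ℝ) (V : (Fin d → ℝ) → ℝ)
    (φ : Xsp d m → ℝ) (x : Xsp d m) : ℝ :=
  - fderiv ℝ φ x (x.2.1, 0, 0)
  + fderiv ℝ φ x (0, (fun i => fderiv ℝ V x.1 (Pi.single i 1)), 0)
  - fderiv ℝ φ x (0, ∑ j, lam j • x.2.2 j, 0)
  + ∑ j, lam j * fderiv ℝ φ x (zdir d m j x.2.1)

lemma contDiff_energy (d m : ℕ) {V : (Fin d → ℝ) → ℝ} {n : WithTop ℕ∞} (hV : ContDiff ℝ n V) :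
    ContDiff ℝ n (energy d m V) := by
  unfold energy
  fun_prop

lemma fderiv_energy_apply {d m : ℕ} {V : (Fin d → ℝ) → ℝ} (hV : Differentiable ℝ V)
    (x v : Xsp d m) :
    fderiv ℝ (energy d m V) x v = fderiv ℝ V x.1 v.1 + ∑ i, x.2.1 i * v.2.1 i +
      ∑ j, ∑ i, x.2.2 j i * v.2.2 j i := by
  have hline : HasDerivAt (fun t : ℝ => energy d m V (x + t • v))
      (fderiv ℝ V x.1 v.1 + ∑ i, x.2.1 i * v.2.1 i + ∑ j, ∑ i, x.2.2 j i * v.2.2 j i) 0 := by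
    have hsq (a b : ℝ) : HasDerivAt (fun t : ℝ => (a + t * b) ^ 2) (2 * (a * b)) 0 := by
      refine ((((hasDerivAt_id (0 : ℝ)).mul_const b).const_add a).pow 2).congr_deriv ?_
      simp; ring
    have h1 : HasDerivAt (fun t : ℝ => V (x.1 + t • v.1)) (fderiv ℝ V x.1 v.1) 0 :=
      (hV x.1).hasFDerivAt.hasLineDerivAt v.1
    have h2 : HasDerivAt (fun t : ℝ => (∑ i, (x.2.1 i + t * v.2.1 i) ^ 2) / 2)
        (∑ i, x.2.1 i * v.2.1 i) 0 := by
      refine ((HasDerivAt.fun_sum (u := Finset.univ)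
        fun i _ => hsq (x.2.1 i) (v.2.1 i)).div_const 2).congr_deriv ?_
      rw [← Finset.mul_sum]; ring
    have h3 : HasDerivAt (fun t : ℝ => (∑ j, ∑ i, (x.2.2 j i + t * v.2.2 j i) ^ 2) / 2)
        (∑ j, ∑ i, x.2.2 j i * v.2.2 j i) 0 := by
      refine ((HasDerivAt.fun_sum (u := Finset.univ) fun j _ =>
        HasDerivAt.fun_sum (u := Finset.univ) fun i _ =>
          hsq (x.2.2 j i) (v.2.2 j i)).div_const 2).congr_deriv ?_
      simp only [← Finset.mul_sum]; ring
    exact (h1.add h2).add h3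
  have hd : DifferentiableAt ℝ (energy d m V) x := by
    have := hV x.1
    unfold energy
    fun_prop
  exact (hd.hasFDerivAt.hasLineDerivAt v).unique hline

lemma hamiltonianPart_energy {d m : ℕ} (lam : Fin m → ℝ) {V : (Fin d → ℝ) → ℝ}
    (hV : Differentiable ℝ V) (x : Xsp d m) :
    hamiltonianPart d m lam V (energy d m V) x = 0 := by
  have h1 : fderiv ℝ V x.1 x.2.1 = ∑ i, x.2.1 i * fderiv ℝ V x.1 (Pi.single i 1) := by
    conv_lhs => rw [← Finset.univ_sum_single x.2.1, map_sum]
    refine Finset.sum_congr rfl fun i _ => ?_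
    rw [← smul_eq_mul, ← map_smul, ← Pi.single_smul]
    simp
  have h2 (j : Fin m) : ∑ j', ∑ i, x.2.2 j' i * (Function.update 0 j x.2.1 : Fin m → Fin d → ℝ) j' i
      = ∑ i, x.2.2 j i * x.2.1 i := by
    rw [Finset.sum_eq_single j]
    · simp
    · intro b _ hb
      simp [Function.update_of_ne hb]
    · simp
  simp only [hamiltonianPart, fderiv_energy_apply hV, zdir, h1, h2]
  simp only [Pi.zero_apply, mul_zero, Finset.sum_const_zero, add_zero, map_zero, zero_add,
    Finset.sum_apply, Pi.smul_apply, smul_eq_mul, Finset.mul_sum]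
  rw [Finset.sum_comm (γ := Fin m)]
  have : ∀ i j, lam j * (x.2.2 j i * x.2.1 i) = x.2.1 i * (lam j * x.2.2 j i) := fun i j => by ring
  simp only [this]
  ring

lemma hamiltonianPart_mul_comp_energy {d m : ℕ} (lam : Fin m → ℝ) {V : (Fin d → ℝ) → ℝ}
    (hV : Differentiable ℝ V) {h : Xsp d m → ℝ} (hh : Differentiable ℝ h) {φ φ' : ℝ → ℝ}
    (hφ : ∀ s, HasDerivAt φ (φ' s) s) (x : Xsp d m) :
    hamiltonianPart d m lam V (fun x => h x ^ 2 / 2 * φ (energy d m V x)) x =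
      h x * φ (energy d m V x) * hamiltonianPart d m lam V h x := by
  have hd : DifferentiableAt ℝ (energy d m V) x := by
    have := hV x.1
    unfold energy
    fun_prop
  have hF : fderiv ℝ (fun x => h x ^ 2 / 2 * φ (energy d m V x)) x =
      (h x * φ (energy d m V x)) • fderiv ℝ h x +
        (h x ^ 2 / 2 * φ' (energy d m V x)) • fderiv ℝ (energy d m V) x := by
    have h1 := ((hh x).hasFDerivAt.pow 2).mul_const (2⁻¹ : ℝ)
    have h2 := (hφ (energy d m V x)).comp_hasFDerivAt x hd.hasFDerivAt
    have h3 := h1.mul h2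
    refine (h3.congr_fderiv ?_).fderiv
    refine ContinuousLinearMap.ext fun v => ?_
    simp
    ring
  have h0 := hamiltonianPart_energy lam hV x
  simp only [hamiltonianPart] at h0 ⊢
  simp only [hF, _root_.add_apply, _root_.smul_apply, smul_eq_mul]
  have hs : ∑ j, lam j * (h x * φ (energy d m V x) * fderiv ℝ h x (zdir d m j x.2.1) +
      h x ^ 2 / 2 * φ' (energy d m V x) * fderiv ℝ (energy d m V) x (zdir d m j x.2.1)) =
      h x * φ (energy d m V x) * ∑ j, lam j * fderiv ℝ h x (zdir d m j x.2.1) +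
      h x ^ 2 / 2 * φ' (energy d m V x) *
        ∑ j, lam j * fderiv ℝ (energy d m V) x (zdir d m j x.2.1) := by
    simp only [Finset.mul_sum, ← Finset.sum_add_distrib]
    exact Finset.sum_congr rfl fun j _ => by ring
  rw [hs]
  linear_combination (h x ^ 2 / 2 * φ' (energy d m V x)) * h0

/-- The Liouville property: the Hamiltonian vector field is divergence free. -/
lemma integral_hamiltonianPart_eq_zero {d m : ℕ} (lam : Fin m → ℝ) {V : (Fin d → ℝ) → ℝ}
    (hV : ContDiff ℝ 1 V) {F : Xsp d m → ℝ} (hF : ContDiff ℝ 1 F) (hper : PerQ d m F)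
    {K : Set ((Fin d → ℝ) × (Fin m → Fin d → ℝ))} (hK : IsCompact K)
    (h0 : ∀ x : Xsp d m, x.2 ∉ K → F x = 0) :
    Integrable (hamiltonianPart d m lam V F) (volX d m) ∧
      ∫ x, hamiltonianPart d m lam V F x ∂(volX d m) = 0 := by
  have hVc : Continuous fun x : Xsp d m => fun i => fderiv ℝ V x.1 (Pi.single i 1) :=
    continuous_pi fun i =>
      ((hV.continuous_fderiv one_ne_zero).comp continuous_fst).clm_apply continuous_const
  have h1 := integral_fderiv_fst_eq_zero hF hper hK h0
  have h2 := integral_fderiv_snd_linear_eq_zero hF hK h0 (LinearMap.inl ℝ _ _)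
    (b := fun x i => fderiv ℝ V x.1 (Pi.single i 1)) hVc (fun x u => by simp)
  have h3 := integral_fderiv_snd_linear_eq_zero hF hK h0 (LinearMap.inl ℝ _ _)
    (b := fun x => ∑ j, lam j • x.2.2 j) (by fun_prop) (fun x u => by simp)
  have h4 (j : Fin m) : Integrable (fun x => fderiv ℝ F x (zdir d m j x.2.1)) (volX d m) ∧
      ∫ x, fderiv ℝ F x (zdir d m j x.2.1) ∂(volX d m) = 0 :=
    integral_fderiv_snd_linear_eq_zero hF hK h0
      (LinearMap.inr ℝ _ _ ∘ₗ LinearMap.single ℝ (fun _ : Fin m => Fin d → ℝ) j)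
      (b := fun x => x.2.1) (by fun_prop) (fun x u => by simp)
  have h5 : Integrable (fun x => ∑ j, lam j * fderiv ℝ F x (zdir d m j x.2.1)) (volX d m) :=
    integrable_finsetSum _ fun j _ => (h4 j).1.const_mul _
  have h6 : ∫ x, ∑ j, lam j * fderiv ℝ F x (zdir d m j x.2.1) ∂(volX d m) = 0 := by
    rw [integral_finsetSum _ fun j _ => (h4 j).1.const_mul (lam j)]
    refine Finset.sum_eq_zero fun j _ => ?_
    rw [integral_const_mul]
    rw [(h4 j).2, mul_zero]
  simp only [LinearMap.inl_apply] at h2 h3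
  refine ⟨((h1.1.neg.add h2.1).sub h3.1).add h5, ?_⟩
  have e1 := integral_add ((h1.1.neg.add h2.1).sub h3.1) h5
  have e2 := integral_sub (h1.1.neg.add h2.1) h3.1
  have e3 := integral_add h1.1.neg h2.1
  have e4 := integral_neg (μ := volX d m) fun x : Xsp d m => fderiv ℝ F x (x.2.1, 0, 0)
  simp only [Pi.add_apply, Pi.sub_apply, Pi.neg_apply] at e1 e2 e3 e4
  simp only [hamiltonianPart]
  rw [e1, e2, e3, e4, h1.2, h2.2, h3.2, h6]
  simp

lemma energy_add_int {d m : ℕ} {V : (Fin d → ℝ) → ℝ} (hVper : PerV d V) :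
    PerQ d m (energy d m V) := fun k x => by
  simp [energy, hVper k x.1]

lemma sq_momentum_le_energy {d m : ℕ} {V : (Fin d → ℝ) → ℝ} {b : ℝ} (hb : ∀ q, b ≤ V q)
    (x : Xsp d m) (i : Fin d) : x.2.1 i ^ 2 ≤ 2 * (energy d m V x - b) := by
  have h1 : (x.2.1 i) ^ 2 ≤ ∑ i, (x.2.1 i) ^ 2 :=
    Finset.single_le_sum (f := fun i => (x.2.1 i) ^ 2) (fun i _ => sq_nonneg _) (Finset.mem_univ i)
  have h2 : 0 ≤ ∑ j, ∑ i, (x.2.2 j i) ^ 2 :=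
    Finset.sum_nonneg fun j _ => Finset.sum_nonneg fun i _ => sq_nonneg _
  simp only [energy]
  linarith [hb x.1]

lemma sq_auxiliary_le_energy {d m : ℕ} {V : (Fin d → ℝ) → ℝ} {b : ℝ} (hb : ∀ q, b ≤ V q)
    (x : Xsp d m) (j : Fin m) (i : Fin d) : x.2.2 j i ^ 2 ≤ 2 * (energy d m V x - b) := by
  have h1 : (x.2.2 j i) ^ 2 ≤ ∑ j, ∑ i, (x.2.2 j i) ^ 2 :=
    (Finset.single_le_sum (f := fun i => (x.2.2 j i) ^ 2) (fun i _ => sq_nonneg _)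
      (Finset.mem_univ i)).trans
    (Finset.single_le_sum (f := fun j => ∑ i, (x.2.2 j i) ^ 2)
      (fun j _ => Finset.sum_nonneg fun i _ => sq_nonneg _) (Finset.mem_univ j))
  have h2 : 0 ≤ ∑ i, (x.2.1 i) ^ 2 := Finset.sum_nonneg fun i _ => sq_nonneg _
  simp only [energy]
  linarith [hb x.1]

/-- Sublevel sets of the energy are contained in cylinders over a compact set. -/
lemma lt_energy_of_snd_notMem {d m : ℕ} {V : (Fin d → ℝ) → ℝ} {b R : ℝ} (hb : ∀ q, b ≤ V q)
    (hbR : b ≤ R) {x : Xsp d m} (hx : x.2 ∉ Metric.closedBall 0 (R - b + 1)) :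
    R < energy d m V x := by
  contrapose! hx
  have hr : 0 ≤ R - b + 1 := by linarith
  have hc (c : ℝ) (hc : c ^ 2 ≤ 2 * (energy d m V x - b)) : ‖c‖ ≤ R - b + 1 :=
    abs_le_of_sq_le_sq (by nlinarith [sq_nonneg (R - b)]) hr
  rw [mem_closedBall_zero_iff, Prod.norm_def, max_le_iff]
  constructor
  · exact (pi_norm_le_iff_of_nonneg hr).2 fun i => hc _ (sq_momentum_le_energy hb x i)
  · exact (pi_norm_le_iff_of_nonneg hr).2 fun j => (pi_norm_le_iff_of_nonneg hr).2 fun i =>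
      hc _ (sq_auxiliary_le_energy hb x j i)

lemma contDiff_pZ {d m : ℕ} {h : Xsp d m → ℝ} (hh : ContDiff ℝ 2 h) (j : Fin m) (k : Fin d) :
    ContDiff ℝ 1 (pZ d m j k h) := by
  unfold pZ
  exact (hh.fderiv_right (m := 1) (by norm_num)).clm_apply contDiff_const

lemma fderiv_zdir {d m : ℕ} (h : Xsp d m → ℝ) (j : Fin m) (v : Fin d → ℝ) (x : Xsp d m) :
    fderiv ℝ h x (zdir d m j v) = ∑ k, v k * pZ d m j k h x := by
  let L : (Fin d → ℝ) →ₗ[ℝ] ℝ :=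
    (fderiv ℝ h x).toLinearMap ∘ₗ (LinearMap.inr ℝ (Fin d → ℝ) _) ∘ₗ
      LinearMap.inr ℝ _ _ ∘ₗ LinearMap.single ℝ (fun _ : Fin m => Fin d → ℝ) j
  change L v = ∑ k, v k * L (Pi.single k 1)
  rw [L.pi_apply_eq_sum_univ]
  refine Finset.sum_congr rfl fun i _ => ?_
  rw [smul_eq_mul]
  congr 2
  ext j
  simp [Pi.single_apply, eq_comm]

lemma fderiv_energy_zdir_single {d m : ℕ} {V : (Fin d → ℝ) → ℝ} (hV : Differentiable ℝ V)
    (j : Fin m) (k : Fin d) (x : Xsp d m) :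
    fderiv ℝ (energy d m V) x (zdir d m j (Pi.single k 1)) = x.2.2 j k := by
  rw [fderiv_energy_apply hV, zdir, Finset.sum_eq_single j]
  · simp [Pi.single_apply]
  · intro b _ hb
    simp [Function.update_of_ne hb]
  · simp

lemma fderiv_mul_pZ_mul_comp_energy {d m : ℕ} {V : (Fin d → ℝ) → ℝ}
    (hV : Differentiable ℝ V) {h : Xsp d m → ℝ} (hh : ContDiff ℝ 2 h) {φ φ' : ℝ → ℝ}
    (hφ : ∀ s, HasDerivAt φ (φ' s) s) (j : Fin m) (k : Fin d) (x : Xsp d m) :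
    fderiv ℝ (fun x => h x * pZ d m j k h x * φ (energy d m V x)) x
        (zdir d m j (Pi.single k 1)) =
      pZ d m j k h x ^ 2 * φ (energy d m V x) +
      h x * fderiv ℝ (pZ d m j k h) x (zdir d m j (Pi.single k 1)) * φ (energy d m V x) +
      h x * pZ d m j k h x * (φ' (energy d m V x) * x.2.2 j k) := by
  have hd : DifferentiableAt ℝ (energy d m V) x := by
    have := hV x.1
    unfold energy
    fun_prop
  have h1 := (hh.differentiable two_ne_zero x).hasFDerivAt.mul
    (((contDiff_pZ hh j k).differentiable one_ne_zero x).hasFDerivAt)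
  have h2 := (h1.mul ((hφ (energy d m V x)).comp_hasFDerivAt x hd.hasFDerivAt)).fderiv
  have h3 : pZ d m j k h x = fderiv ℝ h x (zdir d m j (Pi.single k 1)) := rfl
  refine (DFunLike.congr_fun h2 (zdir d m j (Pi.single k 1))).trans ?_
  simp [fderiv_energy_zdir_single hV, ← h3]
  ring

/-- The energy identity for solutions of `gen h = 0`, localised by a function of the energy. -/
lemma energy_identity {d m : ℕ} {β : ℝ} (hβ : 0 < β) {α lam : Fin m → ℝ}
    {V : (Fin d → ℝ) → ℝ} (hV : ContDiff ℝ 1 V) (hVper : PerV d V) {b R : ℝ}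
    (hb : ∀ q, b ≤ V q) (hbR : b ≤ R) {h : Xsp d m → ℝ} (hh : ContDiff ℝ 2 h)
    (hhper : PerQ d m h) (hker : ∀ x, gen d m β α lam V h x = 0) {φ φ' : ℝ → ℝ}
    (hφ : ∀ s, HasDerivAt φ (φ' s) s) (hφ' : Continuous φ') (hφ0 : ∀ s, R < s → φ s = 0) :
    ∫ x, ∑ j, α j * ∑ k, (pZ d m j k h x ^ 2 * φ (energy d m V x) +
      x.2.2 j k * (h x * pZ d m j k h x) *
        (β * φ (energy d m V x) + φ' (energy d m V x))) ∂(volX d m) = 0 := by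
  have hVd := hV.differentiable one_ne_zero
  have hE : ContDiff ℝ 1 (energy d m V) := contDiff_energy d m hV
  have hφC : ContDiff ℝ 1 φ := by
    rw [contDiff_one_iff_deriv]
    refine ⟨fun s => (hφ s).differentiableAt, ?_⟩
    rwa [show deriv φ = φ' from funext fun s => (hφ s).deriv]
  have hh1 : ContDiff ℝ 1 h := hh.of_le (by norm_num)
  have hK : IsCompact (Metric.closedBall (0 : (Fin d → ℝ) × (Fin m → Fin d → ℝ)) (R - b + 1)) :=
    isCompact_closedBall _ _
  have hw (x : Xsp d m) (hx : x.2 ∉ Metric.closedBall 0 (R - b + 1)) :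
      φ (energy d m V x) = 0 := hφ0 _ (lt_energy_of_snd_notMem hb hbR hx)
  have hwC : ContDiff ℝ 1 fun x => φ (energy d m V x) := hφC.comp hE
  have hham := integral_hamiltonianPart_eq_zero lam hV
    (F := fun x => h x ^ 2 / 2 * φ (energy d m V x)) (by fun_prop)
    (fun k x => by simp only [hhper k x, energy_add_int hVper k x]) hK
    (fun x hx => by simp [hw x hx])
  have hpZ (j k) : ContDiff ℝ 1 (pZ d m j k h) := contDiff_pZ hh j k
  have hdiv (j : Fin m) (k : Fin d) := integral_mul_fderiv_snd_eq_zero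
    (F := fun x => h x * pZ d m j k h x * φ (energy d m V x)) (c := fun _ => 1)
    ((hh1.mul (hpZ j k)).mul hwC) continuous_const hK (fun x hx => by simp [hw x hx])
    (0, Function.update 0 j (Pi.single k 1)) (fun _ _ => rfl)
  simp only [one_mul] at hdiv
  change ∀ j k, Integrable (fun x => fderiv ℝ _ x (zdir d m j (Pi.single k 1))) (volX d m) ∧
    ∫ x, fderiv ℝ _ x (zdir d m j (Pi.single k 1)) ∂(volX d m) = 0 at hdiv
  have hpt (x : Xsp d m) : ∑ j, α j * ∑ k, (pZ d m j k h x ^ 2 * φ (energy d m V x) +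
      x.2.2 j k * (h x * pZ d m j k h x) * (β * φ (energy d m V x) + φ' (energy d m V x))) =
      (∑ j, α j * ∑ k, fderiv ℝ (fun x => h x * pZ d m j k h x * φ (energy d m V x)) x
        (zdir d m j (Pi.single k 1))) -
      β * hamiltonianPart d m lam V (fun x => h x ^ 2 / 2 * φ (energy d m V x)) x := by
    have hk : hamiltonianPart d m lam V h x + ∑ j, α j * fderiv ℝ h x (zdir d m j (x.2.2 j))
      - β⁻¹ * ∑ j, α j * ∑ k, fderiv ℝ (pZ d m j k h) x (zdir d m j (Pi.single k 1)) = 0 :=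
      hker x
    have hham' : β * hamiltonianPart d m lam V h x =
        ∑ j, α j * ∑ k, fderiv ℝ (pZ d m j k h) x (zdir d m j (Pi.single k 1)) -
        β * ∑ j, α j * fderiv ℝ h x (zdir d m j (x.2.2 j)) := by
      linear_combination β * hk + (∑ j, α j * ∑ k, fderiv ℝ (pZ d m j k h) x
        (zdir d m j (Pi.single k 1))) * (mul_inv_cancel₀ hβ.ne')
    rw [hamiltonianPart_mul_comp_energy lam hVd (hh1.differentiable one_ne_zero) hφ]
    rw [show β * (h x * φ (energy d m V x) * hamiltonianPart d m lam V h x) =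
      h x * φ (energy d m V x) * (β * hamiltonianPart d m lam V h x) by ring, hham']
    simp only [fderiv_mul_pZ_mul_comp_energy hVd hh hφ, fderiv_zdir h _ (x.2.2 _)]
    simp only [Finset.mul_sum, ← Finset.sum_sub_distrib]
    exact Finset.sum_congr rfl fun j _ => Finset.sum_congr rfl fun k _ => by ring
  have hi1 (j : Fin m) : Integrable (fun x => α j * ∑ k,
      fderiv ℝ (fun x => h x * pZ d m j k h x * φ (energy d m V x)) x
        (zdir d m j (Pi.single k 1))) (volX d m) :=
    (integrable_finsetSum _ fun k _ => (hdiv j k).1).const_mul _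
  simp only [hpt]
  rw [integral_sub (integrable_finsetSum _ fun j _ => hi1 j) (hham.1.const_mul β),
    integral_const_mul, hham.2, mul_zero, sub_zero, integral_finsetSum _ fun j _ => hi1 j]
  refine Finset.sum_eq_zero fun j _ => ?_
  rw [integral_const_mul, integral_finsetSum _ fun k _ => (hdiv j k).1]
  exact mul_eq_zero_of_right _ (Finset.sum_eq_zero fun k _ => (hdiv j k).2)

lemma hasDerivAt_max_zero_sq (s : ℝ) : HasDerivAt (fun s : ℝ => max 0 s ^ 2) (2 * max 0 s) s := by
  rcases lt_trichotomy s 0 with hs | rfl | hs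
  · refine ((hasDerivAt_const s (0 : ℝ)).congr_of_eventuallyEq ?_).congr_deriv
      (by simp [max_eq_left hs.le])
    filter_upwards [Iio_mem_nhds hs] with t ht
    simp [max_eq_left (Set.mem_Iio.1 ht).le]
  · rw [hasDerivAt_iff_isLittleO_nhds_zero]
    refine Asymptotics.IsBigO.trans_isLittleO (g := fun t : ℝ => t ^ 2) ?_ ?_
    · refine Asymptotics.IsBigO.of_bound 1 (Eventually.of_forall fun t => ?_)
      rcases le_total t 0 with ht | ht <;> simp [ht, sq_nonneg]
    · simpa using Asymptotics.isLittleO_pow_id (𝕜 := ℝ) one_lt_two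
  · refine ((hasDerivAt_pow 2 s).congr_of_eventuallyEq ?_).congr_deriv
      (by simp [max_eq_right hs.le])
    filter_upwards [Ioi_mem_nhds hs] with t ht
    rw [max_eq_right (Set.mem_Ioi.1 ht).le]

lemma exists_forall_le_of_perV {d : ℕ} {V : (Fin d → ℝ) → ℝ} (hV : Continuous V)
    (hVper : PerV d V) : ∃ b, ∀ q, b ≤ V q := by
  obtain ⟨q₀, _, hq₀⟩ := (isCompact_Icc (a := (0 : Fin d → ℝ)) (b := 1)).exists_isMinOn
    (Set.nonempty_Icc.2 zero_le_one) hV.continuousOn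
  refine ⟨V q₀, fun q => ?_⟩
  have h := hVper (fun i => -⌊q i⌋) q
  rw [← h]
  refine hq₀ ⟨fun i => ?_, fun i => ?_⟩
  · simp [Int.floor_le]
  · simpa using (Int.lt_floor_add_one (q i)).le.trans_eq (add_comm _ _)

lemma Continuous.eq_zero_of_ae_volX {d m : ℕ} {f : Xsp d m → ℝ} (hf : Continuous f)
    (hper : PerQ d m f) (h0 : f =ᵐ[volX d m] 0) (x : Xsp d m) : f x = 0 := by
  have hset : {x : Xsp d m | x.1 ∈ cube d} = (Set.univ.pi fun _ => Set.Ico (0 : ℝ) 1) ×ˢ Set.univ := by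
    ext; simp [cube_eq_pi]
  have key : Set.EqOn f 0 {x : Xsp d m | x.1 ∈ cube d} := by
    refine Measure.eqOn_of_ae_eq h0 hf.continuousOn continuousOn_const ?_
    rw [hset, interior_prod_eq, closure_prod_eq, interior_pi_set Set.finite_univ, closure_pi_set]
    simp only [interior_Ico, interior_univ, closure_univ, closure_Ioo (zero_ne_one' ℝ)]
    exact Set.prod_mono (Set.pi_mono fun _ _ => Set.Ico_subset_Icc_self) subset_rfl
  rw [← hper (fun i => -⌊x.1 i⌋) x]
  refine key fun i => ?_
  exact ⟨by simp [Int.floor_le],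
    by simpa using (Int.lt_floor_add_one (x.1 i)).trans_eq (add_comm _ _)⟩

lemma integrable_mul_exp_energy_of_gibbs {d m : ℕ} {β Z : ℝ} (hZ : 0 < Z)
    {V : (Fin d → ℝ) → ℝ} (hV : Continuous V) {f : Xsp d m → ℝ}
    (hf : Integrable f (gibbs d m β Z V)) :
    Integrable (fun x => f x * Real.exp (-β * energy d m V x)) (volX d m) := by
  have hE : Continuous (energy d m V) := by unfold energy; fun_prop
  have hg : Continuous (gdens d m β V) :=
    Real.continuous_exp.comp (continuous_const.mul hE)
  rw [gibbs, integrable_withDensity_iff (by fun_prop) (Eventually.of_forall fun _ => by simp)] at hf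
  refine (hf.mul_const Z).congr (Eventually.of_forall fun x => ?_)
  have : 0 ≤ Z⁻¹ * gdens d m β V x := mul_nonneg (inv_nonneg.2 hZ.le) (Real.exp_pos _).le
  simp only [ENNReal.toReal_ofReal this]
  rw [show Real.exp (-β * energy d m V x) = gdens d m β V x from rfl]
  field_simp

lemma fderiv_add_int {d m : ℕ} {h : Xsp d m → ℝ} (hper : PerQ d m h) (k : Fin d → ℤ)
    (x : Xsp d m) : fderiv ℝ h (x.1 + (fun i => (k i : ℝ)), x.2) = fderiv ℝ h x := by
  have h1 : (fun y : Xsp d m => h (y + ((fun i => (k i : ℝ)), 0))) = h := by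
    ext y
    rw [← hper k y]
    congr 1
    ext <;> simp
  have h2 := fderiv_comp_add_right (𝕜 := ℝ) (f := h) (x := x)
    (((fun i => (k i : ℝ)), 0) : Xsp d m)
  rw [h1] at h2
  rw [h2]
  congr 1
  ext <;> simp

/-- Continuously differentiable cutoffs of the half-line `[b, ∞)` at scale `n + 1`. -/
lemma exists_cutoff (b : ℝ) : ∃ χ χ' : ℕ → ℝ → ℝ,
    (∀ n s, HasDerivAt (χ n) (χ' n s) s) ∧ (∀ n, Continuous (χ' n)) ∧
    (∀ n s, b ≤ s → 0 ≤ χ n s ∧ χ n s ≤ 1) ∧ (∀ (n : ℕ) s, b + (n + 1) < s → χ n s = 0) ∧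
    (∀ n s z, z ^ 2 ≤ 2 * (s - b) → |z * χ' n s| ≤ 4) ∧
    (∀ s, Tendsto (fun n => χ n s) atTop (nhds 1)) ∧
    (∀ s, Tendsto (fun n => χ' n s) atTop (nhds 0)) := by
  let cut : ℕ → ℝ → ℝ := fun n s => max 0 (1 - (s - b) / (n + 1))
  have hcut0 (n s) : 0 ≤ cut n s := le_max_left _ _
  have hcut1 (n s) (hs : b ≤ s) : cut n s ≤ 1 := by
    refine max_le zero_le_one ?_
    have := div_nonneg (sub_nonneg.2 hs) (by positivity : (0 : ℝ) ≤ n + 1)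
    linarith
  have hcut (n : ℕ) (s) (hs : b + (n + 1) < s) : cut n s = 0 := by
    have : 1 ≤ (s - b) / (n + 1) := by rw [le_div_iff₀ (by positivity)]; linarith
    exact max_eq_left (sub_nonpos.2 this)
  have hlim (s) : Tendsto (fun n => cut n s) atTop (nhds 1) := by
    have h1 : Tendsto (fun n : ℕ => (s - b) / ((n : ℝ) + 1)) atTop (nhds 0) := by
      have := (tendsto_const_div_atTop_nhds_zero_nat (s - b)).comp (tendsto_add_atTop_nat 1)
      simpa [Function.comp_def] using this
    have := (tendsto_const_nhds (x := (0 : ℝ))).max (h1.const_sub 1)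
    simpa using this
  refine ⟨fun n s => cut n s ^ 2, fun n s => - (2 * cut n s / (n + 1)), fun n s => ?_,
    fun n => by fun_prop, fun n s hs => ⟨sq_nonneg _, pow_le_one₀ (hcut0 n s) (hcut1 n s hs)⟩,
    fun n s hs => by simp [hcut n s hs], fun n s z hz => ?_, fun s => ?_, fun s => ?_⟩
  · have h1 : HasDerivAt (fun s : ℝ => 1 - (s - b) / (n + 1)) (-(1 / ((n : ℝ) + 1))) s :=
      (((hasDerivAt_id s).sub_const b).div_const _).const_sub 1
    refine ((hasDerivAt_max_zero_sq _).comp s h1).congr_deriv ?_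
    simp only [cut]
    ring
  · have hn : (1 : ℝ) ≤ n + 1 := by simp
    rcases lt_or_ge (b + (n + 1)) s with hs | hs
    · simp [hcut n s hs]
    · have hz' : |z| ≤ 2 * (n + 1) := by
        refine abs_le_of_sq_le_sq ?_ (by positivity)
        nlinarith
      have h2 : |-(2 * cut n s / ((n : ℝ) + 1))| ≤ 2 / (n + 1) := by
        rw [abs_neg, abs_of_nonneg (by have := hcut0 n s; positivity)]
        gcongr
        linarith [hcut1 n s (by nlinarith [sq_nonneg z])]
      rw [abs_mul]
      calc _ ≤ (2 * ((n : ℝ) + 1)) * (2 / (n + 1)) := by gcongr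
        _ = 4 := by field_simp; norm_num
  · simpa using (hlim s).pow 2
  · have := (((hlim s).const_mul 2).mul (tendsto_one_div_add_atTop_nhds_zero_nat (𝕜 := ℝ))).neg
    simpa [div_eq_mul_inv] using this

/-- The dissipation vanishes: a solution of `gen h = 0` which is square integrable together with
its first derivatives does not depend on the auxiliary variables. -/
lemma pZ_eq_zero_of_gen_eq_zero {d m : ℕ} {β : ℝ} (hβ : 0 < β) {α lam : Fin m → ℝ}
    (hα : ∀ j, 0 < α j) {V : (Fin d → ℝ) → ℝ} (hV : ContDiff ℝ 1 V) (hVper : PerV d V)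
    {h : Xsp d m → ℝ} (hh : ContDiff ℝ 2 h) (hhper : PerQ d m h)
    (hker : ∀ x, gen d m β α lam V h x = 0)
    (hint : Integrable (fun x => h x ^ 2 * Real.exp (-β * energy d m V x)) (volX d m))
    (hint' : ∀ j k, Integrable (fun x => pZ d m j k h x ^ 2 * Real.exp (-β * energy d m V x))
      (volX d m)) (j : Fin m) (k : Fin d) (x : Xsp d m) : pZ d m j k h x = 0 := by
  obtain ⟨b, hb⟩ := exists_forall_le_of_perV hV.continuous hVper
  have hE : Continuous (energy d m V) := (contDiff_energy d m hV).continuous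
  have hpZ (j k) : Continuous (pZ d m j k h) := (contDiff_pZ hh j k).continuous
  have hhc : Continuous h := hh.continuous
  obtain ⟨e, he⟩ : ∃ e : Xsp d m → ℝ, ∀ x, e x = Real.exp (-β * energy d m V x) := ⟨_, fun _ => rfl⟩
  simp only [← he] at hint hint'
  have hec : Continuous e := by
    rw [funext he]
    fun_prop
  have he0 (x) : 0 < e x := he x ▸ Real.exp_pos _
  obtain ⟨χ, η', hη, hη'c, hχ, hχ0, hzη', hlimχ, hlimη⟩ := exists_cutoff b
  have hχc (n) : Continuous (χ n) :=
    continuous_iff_continuousAt.2 fun s => (hη n s).continuousAt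
  have hid (n : ℕ) : ∫ x, ∑ j, α j * ∑ k, (pZ d m j k h x ^ 2 * e x * χ n (energy d m V x) +
      (h x * pZ d m j k h x) * e x * (x.2.2 j k * η' n (energy d m V x))) ∂(volX d m) = 0 := by
    have hn : (0 : ℝ) < n + 1 := by positivity
    have key := energy_identity (φ := fun s => Real.exp (-β * s) * χ n s)
      (φ' := fun s => Real.exp (-β * s) * (-β) * χ n s + Real.exp (-β * s) * η' n s)
      (R := b + (n + 1)) hβ hV hVper hb (by linarith) hh hhper hker
      (fun s => by
        have h1 : HasDerivAt (fun s => Real.exp (-β * s)) (Real.exp (-β * s) * (-β)) s := by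
          simpa using ((hasDerivAt_id s).const_mul (-β)).exp
        exact h1.mul (hη n s))
      (by fun_prop)
      (fun s hs => by simp [hχ0 n s hs])
    rw [← key]
    congr 1
    ext x
    refine Finset.sum_congr rfl fun j _ => ?_
    congr 1
    refine Finset.sum_congr rfl fun k _ => ?_
    simp only [he]
    ring
  have hb0 (x) : b ≤ energy d m V x := by
    have h1 : 0 ≤ ∑ i, (x.2.1 i) ^ 2 := Finset.sum_nonneg fun i _ => sq_nonneg _
    have h2 : 0 ≤ ∑ j, ∑ i, (x.2.2 j i) ^ 2 :=
      Finset.sum_nonneg fun j _ => Finset.sum_nonneg fun i _ => sq_nonneg _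
    have := hb x.1
    simp only [energy]; linarith
  have hzη (n : ℕ) (x : Xsp d m) (j k) : |x.2.2 j k * η' n (energy d m V x)| ≤ 4 :=
    hzη' n _ _ (sq_auxiliary_le_energy hb x j k)
  have hmix (j k) : Integrable (fun x => |h x * pZ d m j k h x| * e x) (volX d m) := by
    have hc : Continuous fun x => |h x * pZ d m j k h x| * e x := (hhc.mul (hpZ j k)).abs.mul hec
    refine (hint.add (hint' j k)).mono' hc.aestronglyMeasurable (Eventually.of_forall fun x => ?_)
    rw [Real.norm_of_nonneg (mul_nonneg (abs_nonneg _) (he0 x).le), Pi.add_apply, ← add_mul,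
      abs_mul]
    refine mul_le_mul_of_nonneg_right ?_ (he0 x).le
    nlinarith [sq_abs (h x), sq_abs (pZ d m j k h x), sq_nonneg (|h x| - |pZ d m j k h x|),
      sq_nonneg (h x), sq_nonneg (pZ d m j k h x)]
  have hI : Integrable (fun x => ∑ j, α j * ∑ k, (pZ d m j k h x ^ 2 * e x +
      |h x * pZ d m j k h x| * e x * 4)) (volX d m) := by
    refine integrable_finsetSum _ fun j _ => ?_
    refine Integrable.const_mul ?_ (α j)
    refine integrable_finsetSum _ fun k _ => ?_
    exact (hint' j k).add ((hmix j k).mul_const 4)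
  have hI' : Integrable (fun x => ∑ j, α j * ∑ k, pZ d m j k h x ^ 2 * e x) (volX d m) := by
    refine integrable_finsetSum _ fun j _ => ?_
    refine Integrable.const_mul ?_ (α j)
    exact integrable_finsetSum _ fun k _ => hint' j k
  have htend := tendsto_integral_of_dominated_convergence (μ := volX d m)
    (F := fun n x => ∑ j, α j * ∑ k, (pZ d m j k h x ^ 2 * e x * χ n (energy d m V x) +
      (h x * pZ d m j k h x) * e x * (x.2.2 j k * η' n (energy d m V x))))
    (f := fun x => ∑ j, α j * ∑ k, pZ d m j k h x ^ 2 * e x)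
    (fun x => ∑ j, α j * ∑ k, (pZ d m j k h x ^ 2 * e x + |h x * pZ d m j k h x| * e x * 4))
    (fun n => by
      refine Continuous.aestronglyMeasurable ?_
      fun_prop)
    hI
    (fun n => Eventually.of_forall fun x => by
      refine norm_sum_le_of_le _ fun j _ => ?_
      rw [norm_mul, Real.norm_of_nonneg (hα j).le]
      refine mul_le_mul_of_nonneg_left ?_ (hα j).le
      refine norm_sum_le_of_le _ fun k _ => ?_
      refine (norm_add_le _ _).trans (add_le_add ?_ ?_)
      · rw [Real.norm_of_nonneg (mul_nonneg (mul_nonneg (sq_nonneg _) (he0 x).le)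
          (hχ n _ (hb0 x)).1)]
        exact mul_le_of_le_one_right (by have := he0 x; positivity)
          (hχ n _ (hb0 x)).2
      · rw [norm_mul, norm_mul, Real.norm_of_nonneg (he0 x).le]
        exact mul_le_mul_of_nonneg_left (hzη n x j k) (by have := he0 x; positivity))
    (Eventually.of_forall fun x => by
      refine tendsto_finsetSum _ fun j _ => ?_
      refine Tendsto.const_mul (α j) ?_
      refine tendsto_finsetSum _ fun k _ => ?_
      have h1 := ((hlimχ (energy d m V x)).const_mul (pZ d m j k h x ^ 2 * e x)).add
        (((hlimη (energy d m V x)).const_mul (x.2.2 j k)).const_mul ((h x * pZ d m j k h x) * e x))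
      simpa using h1)
  simp only [hid] at htend
  have h0 := tendsto_nhds_unique htend tendsto_const_nhds
  have hnn (x) (j) (k) : 0 ≤ pZ d m j k h x ^ 2 * e x := mul_nonneg (sq_nonneg _) (he0 x).le
  have hnn' (x) (j) : 0 ≤ α j * ∑ k, pZ d m j k h x ^ 2 * e x :=
    mul_nonneg (hα j).le (Finset.sum_nonneg fun k _ => hnn x j k)
  rw [integral_eq_zero_iff_of_nonneg (fun x => Finset.sum_nonneg fun j _ => hnn' x j)
    hI'] at h0
  refine (hpZ j k).eq_zero_of_ae_volX
    (fun l y => by simp only [pZ, fderiv_add_int hhper l y]) ?_ x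
  filter_upwards [h0] with y hy
  have h1 := (Finset.sum_eq_zero_iff_of_nonneg fun j _ => hnn' y j).1 hy j (Finset.mem_univ j)
  have h2 := (mul_eq_zero.1 h1).resolve_left (hα j).ne'
  have h3 := (Finset.sum_eq_zero_iff_of_nonneg fun k _ => hnn y j k).1 h2 k (Finset.mem_univ k)
  exact pow_eq_zero_iff two_ne_zero |>.1 ((mul_eq_zero.1 h3).resolve_right (he0 y).ne')

lemma zdir_sum {d m : ℕ} (c : Fin m → Fin d → ℝ) :
    ∑ j, zdir d m j (c j) = (0, 0, c) := by
  ext j k <;> simp [zdir, Prod.fst_sum, Prod.snd_sum, Finset.sum_apply, Function.update_apply,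
    ite_apply]

lemma fderiv_apply_eq_zero_of_pZ_eq_zero {d m : ℕ} {h : Xsp d m → ℝ}
    (hz : ∀ j k x, pZ d m j k h x = 0) (x : Xsp d m) (c : Fin m → Fin d → ℝ) :
    fderiv ℝ h x (0, 0, c) = 0 := by
  simp [← zdir_sum, map_sum, fderiv_zdir, hz]

/-- A function whose derivative vanishes in a direction has translation invariant derivative in
that direction. -/
lemma fderiv_add_eq_of_fderiv_apply_eq_zero {E : Type*} [NormedAddCommGroup E] [NormedSpace ℝ E]
    {h : E → ℝ} (hh : Differentiable ℝ h) {w : E} (hw : ∀ x, fderiv ℝ h x w = 0) (x : E) :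
    fderiv ℝ h (x + w) = fderiv ℝ h x := by
  have h1 : (fun y => h (y + w)) = h := by
    ext y
    have hd (t : ℝ) : HasDerivAt (fun t : ℝ => h (y + t • w)) 0 t := by
      refine ((hh (y + t • w)).hasFDerivAt.comp_hasDerivAt t
        (((hasDerivAt_id t).smul_const w).const_add y)).congr_deriv ?_
      rw [one_smul, hw]
    have := is_const_of_deriv_eq_zero (fun t => (hd t).differentiableAt) (fun t => (hd t).deriv) 1 0
    simpa using this
  rw [← fderiv_comp_add_right, h1]

lemma fderiv_eq_zero_of_gen_eq_zero {d m : ℕ} (hm : 1 ≤ m) {β : ℝ} {α lam : Fin m → ℝ}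
    (hlam : ∀ j, lam j ≠ 0) {V : (Fin d → ℝ) → ℝ} {h : Xsp d m → ℝ} (hh : Differentiable ℝ h)
    (hker : ∀ x, gen d m β α lam V h x = 0) (hz : ∀ j k x, pZ d m j k h x = 0) (x : Xsp d m) :
    fderiv ℝ h x = 0 := by
  have hz' := fderiv_apply_eq_zero_of_pZ_eq_zero hz
  have hzf (j k) : pZ d m j k h = fun _ => 0 := funext (hz j k)
  have hred (q p z) : fderiv ℝ h (q, p, z) (0, ∑ j, lam j • z j, 0) =
      - fderiv ℝ h (q, p, 0) (p, 0, 0) +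
        fderiv ℝ h (q, p, 0) (0, (fun i => fderiv ℝ V q (Pi.single i 1)), 0) := by
    have h1 := hker (q, p, z)
    have h2 := fderiv_add_eq_of_fderiv_apply_eq_zero hh (fun x => hz' x z) (q, p, 0)
    simp only [Prod.mk_add_mk, add_zero, zero_add] at h2
    simp only [gen, zdir, hz', hzf, fderiv_fun_const, Pi.zero_apply,
      zero_apply, mul_zero, Finset.sum_const_zero, h2] at h1
    rw [h2]
    linarith
  have hp (x : Xsp d m) (v : Fin d → ℝ) : fderiv ℝ h x (0, v, 0) = 0 := by
    obtain ⟨q, p, z⟩ := x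
    have hzero := hred q p 0
    have h3 := hred q p (Function.update 0 ⟨0, hm⟩ ((lam ⟨0, hm⟩)⁻¹ • v))
    have hs : ∑ j, lam j • (Function.update (0 : Fin m → Fin d → ℝ) ⟨0, hm⟩
        ((lam ⟨0, hm⟩)⁻¹ • v)) j = v := by
      rw [Finset.sum_eq_single ⟨0, hm⟩]
      · simp [smul_smul, hlam]
      · intro j _ hj
        simp [Function.update_of_ne hj]
      · simp
    have h4 (z') := fderiv_add_eq_of_fderiv_apply_eq_zero hh (fun x => hz' x z') (q, p, 0)
    simp only [Prod.mk_add_mk, add_zero, zero_add] at h4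
    rw [hs, ← hzero, h4] at h3
    rw [h4, h3]
    have h5 : ((0, ∑ j, lam j • (0 : Fin m → Fin d → ℝ) j, 0) : Xsp d m) = 0 := by simp
    rw [h5, map_zero]
  have hq (x : Xsp d m) (v : Fin d → ℝ) : fderiv ℝ h x (v, 0, 0) = 0 := by
    have h1 := hred x.1 v 0
    rw [hp, hp] at h1
    have h2 := fderiv_add_eq_of_fderiv_apply_eq_zero hh (w := (0, v - x.2.1, - x.2.2)) (fun y => by
      have : ((0, v - x.2.1, - x.2.2) : Xsp d m) = (0, v - x.2.1, 0) + (0, 0, - x.2.2) := by simp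
      rw [this, map_add, hp, hz', add_zero]) x
    have h3 : x + (0, v - x.2.1, - x.2.2) = (x.1, v, 0) := by ext <;> simp
    rw [← h2, h3]
    linarith
  ext v
  · exact hq x v
  · exact hp x v
  · exact hz' x v

/-- (Characterization of the kernel of the generator.) Assume
`V ∈ C^∞(𝕋^d)`. If `h ∈ C^∞(X)` satisfies `𝓛h = 0` pointwise and `h` together with all
its partial derivatives belongs to `L²(μ_β)`, then `h` is constant. -/
theorem kernel_gen_constants
    (d m : ℕ) (hd : 1 ≤ d) (hm : 1 ≤ m)
    (β : ℝ) (hβ : 0 < β)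
    (α lam : Fin m → ℝ) (hα : ∀ j, 0 < α j) (hlam : ∀ j, 0 < lam j)
    (V : (Fin d → ℝ) → ℝ) (hV : ContDiff ℝ (⊤ : ℕ∞) V) (hVper : PerV d V)
    (Z : ℝ) (hZ : 0 < Z)
    (hprob : IsProbabilityMeasure (gibbs d m β Z V))
    (h : Xsp d m → ℝ) (hh : ContDiff ℝ (⊤ : ℕ∞) h) (hhper : PerQ d m h)
    (hL2 : ∀ (n : ℕ) (v : Fin n → Xsp d m),
      Integrable (fun x => (iteratedFDeriv ℝ n h x v) ^ 2) (gibbs d m β Z V))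
    (hker : ∀ x, gen d m β α lam V h x = 0) :
    ∃ c : ℝ, ∀ x, h x = c := by
  have hint := integrable_mul_exp_energy_of_gibbs hZ hV.continuous (hL2 0 ![])
  have hint' (j : Fin m) (k : Fin d) := integrable_mul_exp_energy_of_gibbs hZ hV.continuous
    (hL2 1 ![zdir d m j (Pi.single k 1)])
  simp only [iteratedFDeriv_zero_apply] at hint
  simp only [iteratedFDeriv_one_apply, Matrix.cons_val_zero] at hint'
  have hh2 : ContDiff ℝ 2 h := contDiff_infty.1 hh 2
  have hV1 : ContDiff ℝ 1 V := contDiff_infty.1 hV 1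
  have hz := pZ_eq_zero_of_gen_eq_zero hβ hα hV1 hVper hh2 hhper hker hint hint'
  have hdiff : Differentiable ℝ h := hh2.differentiable two_ne_zero
  exact ⟨h 0, fun x => is_const_of_fderiv_eq_zero hdiff
    (fderiv_eq_zero_of_gen_eq_zero hm (fun j => (hlam j).ne') hdiff hker hz) x 0⟩
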